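/- Let (B,‖·‖) be a separable real Banach space, s > 0, ν ∈ M_s(B), and X, Y be B-valued random variables with L(X), L(Y) ∈ M_s(ν). Let A be a random continuous linear operator on B (i.e., a random variable with values in the space of bounded linear operators B → B, measurable with respect to the σ-algebra generated by the evaluation maps a ↦ a(x), x ∈ B) with E[‖A‖_op^s] < ∞, and assume A is independent of X and of Y. Then ζ_s(A(X), A(Y)) ≤ E[‖A‖_op^s] · ζ_s(X, Y). The same bound holds when A is a random continuous linear form on B, i.e., takes values in the dual space B* equipped with the σ-algebra generated by the evaluation maps a ↦ a(x), x ∈ B. -/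

import Mathlib

open MeasureTheory ProbabilityTheory Filter
open scoped ENNReal NNReal Topology

noncomputable section

/-- The Zolotarev class of test functions of order `s`. -/
def zolotarevClass (E : Type*) [NormedAddCommGroup E] [NormedSpace ℝ E] (s : ℝ) : Set (E → ℝ) :=
  {f | ContDiff ℝ (⌈s⌉₊ - 1 : ℕ) f ∧
    ∀ x y : E, ‖iteratedFDeriv ℝ (⌈s⌉₊ - 1) f x - iteratedFDeriv ℝ (⌈s⌉₊ - 1) f y‖
      ≤ ‖x - y‖ ^ (s - (⌈s⌉₊ - 1 : ℕ))}

/-- The Zolotarev distance of order `s`. -/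
def zolotarevDist {E : Type*} [NormedAddCommGroup E] [NormedSpace ℝ E] [MeasurableSpace E]
    (s : ℝ) (μ ν : Measure E) : ℝ≥0∞ :=
  ⨆ f ∈ zolotarevClass E s, ENNReal.ofReal |∫ x, f x ∂μ - ∫ x, f x ∂ν|

/-- `μ ∈ M_s(E)`: probability measures with finite absolute moment of order `s`. -/
def MemMs {E : Type*} [NormedAddCommGroup E] [NormedSpace ℝ E] [MeasurableSpace E]
    (s : ℝ) (μ : Measure E) : Prop :=
  IsProbabilityMeasure μ ∧ ∫⁻ x, ENNReal.ofReal (‖x‖ ^ s) ∂μ < ∞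

/-- `μ ∈ M_s(ν)`: members of `M_s(E)` whose mixed moments up to order `m = ⌈s⌉ - 1` agree with
those of `ν`. -/
def MemMsOf {E : Type*} [NormedAddCommGroup E] [NormedSpace ℝ E] [MeasurableSpace E]
    (s : ℝ) (ν μ : Measure E) : Prop :=
  MemMs s μ ∧ ∀ k : ℕ, 1 ≤ k → k ≤ ⌈s⌉₊ - 1 →
    ∀ f : ContinuousMultilinearMap ℝ (fun _ : Fin k => E) ℝ,
      ∫ x, f (fun _ => x) ∂μ = ∫ x, f (fun _ => x) ∂ν

/-- The σ-algebra on continuous linear maps generated by the evaluation maps `a ↦ a x`. -/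
def evalSigma (B F : Type*) [NormedAddCommGroup B] [NormedSpace ℝ B]
    [NormedAddCommGroup F] [NormedSpace ℝ F] [MeasurableSpace F] :
    MeasurableSpace (B →L[ℝ] F) :=
  ⨆ x : B, MeasurableSpace.comap (fun a : B →L[ℝ] F => a x) inferInstance

theorem norm_le_of_norm_fderiv_le_rpow {E G : Type*} [NormedAddCommGroup E] [NormedSpace ℝ E]
    [NormedAddCommGroup G] [NormedSpace ℝ G] {g : E → G} (hg : Differentiable ℝ g)
    {C p : ℝ} (hC : 0 ≤ C) (hp : 0 ≤ p) (h : ∀ y, ‖fderiv ℝ g y‖ ≤ C * (1 + ‖y‖) ^ p) (x : E) :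
    ‖g x‖ ≤ (‖g 0‖ + C) * (1 + ‖x‖) ^ (p + 1) := by
  have hx : 0 ≤ ‖x‖ := norm_nonneg x
  have hmv : ‖g x - g 0‖ ≤ C * (1 + ‖x‖) ^ p * ‖x - 0‖ := by
    refine (convex_closedBall (0 : E) ‖x‖).norm_image_sub_le_of_norm_fderiv_le (𝕜 := ℝ)
      (fun y _ => hg y) (fun y hy => (h y).trans ?_) (by simp) (by simp)
    have hy' : ‖y‖ ≤ ‖x‖ := by simpa using hy
    gcongr
  rw [sub_zero] at hmv
  have h1 : 1 ≤ (1 + ‖x‖) ^ (p + 1) := Real.one_le_rpow (by linarith) (by linarith)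
  have h2 : (1 + ‖x‖) ^ (p + 1) = (1 + ‖x‖) ^ p * (1 + ‖x‖) := by
    rw [Real.rpow_add (by linarith), Real.rpow_one]
  have h3 : C * (1 + ‖x‖) ^ p * ‖x‖ ≤ C * (1 + ‖x‖) ^ (p + 1) := by
    rw [h2, ← mul_assoc]
    gcongr
    linarith
  have h4 : ‖g x‖ ≤ ‖g x - g 0‖ + ‖g 0‖ := by simpa using norm_add_le (g x - g 0) (g 0)
  nlinarith [norm_nonneg (g 0)]

theorem one_add_rpow_le {s u : ℝ} (hs : 0 ≤ s) (hu : 0 ≤ u) :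
    (1 + u) ^ s ≤ 2 ^ s * (1 + u ^ s) := by
  have hu' : 0 ≤ u ^ s := Real.rpow_nonneg hu s
  have h2 : (0 : ℝ) ≤ 2 ^ s := by positivity
  rcases le_total u 1 with h | h
  · calc (1 + u) ^ s ≤ 2 ^ s := by gcongr; linarith
      _ ≤ _ := by nlinarith
  · calc (1 + u) ^ s ≤ (2 * u) ^ s := by gcongr; linarith
      _ = 2 ^ s * u ^ s := Real.mul_rpow (by norm_num) hu
      _ ≤ _ := by nlinarith

theorem ceil_sub_one_lt {s : ℝ} (hs : 0 < s) : ((⌈s⌉₊ - 1 : ℕ) : ℝ) < s := by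
  have h1 : 0 < ⌈s⌉₊ := Nat.ceil_pos.2 hs
  exact Nat.lt_ceil.1 (by omega)

theorem zolotarevClass.norm_iteratedFDeriv_le {E : Type*} [NormedAddCommGroup E]
    [NormedSpace ℝ E] {s : ℝ} (hs : 0 < s) {f : E → ℝ} (hf : f ∈ zolotarevClass E s) (k : ℕ)
    (hk : k ≤ ⌈s⌉₊ - 1) :
    ∃ C, 0 ≤ C ∧ ∀ x, ‖iteratedFDeriv ℝ k f x‖ ≤ C * (1 + ‖x‖) ^ (s - k) := by
  have hα := ceil_sub_one_lt hs
  induction hk using Nat.decreasingInduction with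
  | self =>
    refine ⟨‖iteratedFDeriv ℝ (⌈s⌉₊ - 1) f 0‖ + 1, by positivity, fun x => ?_⟩
    have hx : 0 ≤ ‖x‖ := norm_nonneg x
    have h0 := hf.2 x 0
    rw [sub_zero] at h0
    have h1 : ‖x‖ ^ (s - (⌈s⌉₊ - 1 : ℕ)) ≤ (1 + ‖x‖) ^ (s - (⌈s⌉₊ - 1 : ℕ)) :=
      Real.rpow_le_rpow hx (by linarith) (by linarith)
    have h2 : 1 ≤ (1 + ‖x‖) ^ (s - (⌈s⌉₊ - 1 : ℕ)) :=
      Real.one_le_rpow (by linarith) (by linarith)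
    have h3 := norm_add_le (iteratedFDeriv ℝ (⌈s⌉₊ - 1) f x - iteratedFDeriv ℝ (⌈s⌉₊ - 1) f 0)
      (iteratedFDeriv ℝ (⌈s⌉₊ - 1) f 0)
    rw [sub_add_cancel] at h3
    nlinarith [norm_nonneg (iteratedFDeriv ℝ (⌈s⌉₊ - 1) f 0)]
  | of_succ k hk ih =>
    obtain ⟨C, hC, h⟩ := ih
    have hks : ((k + 1 : ℕ) : ℝ) ≤ (⌈s⌉₊ - 1 : ℕ) := by exact_mod_cast hk
    refine ⟨‖iteratedFDeriv ℝ k f 0‖ + C, by positivity, fun x => ?_⟩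
    have hd : Differentiable ℝ (iteratedFDeriv ℝ k f) :=
      hf.1.differentiable_iteratedFDeriv (by exact_mod_cast hk)
    have := norm_le_of_norm_fderiv_le_rpow hd hC (p := s - (k + 1 : ℕ)) (by linarith)
      (fun y => by rw [norm_fderiv_iteratedFDeriv]; exact h y) x
    convert this using 3
    push_cast
    ring

theorem zolotarevClass.exists_abs_le {E : Type*} [NormedAddCommGroup E] [NormedSpace ℝ E]
    {s : ℝ} (hs : 0 < s) {f : E → ℝ} (hf : f ∈ zolotarevClass E s) :
    ∃ C, 0 ≤ C ∧ ∀ x, |f x| ≤ C * (1 + ‖x‖ ^ s) := by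
  obtain ⟨C, hC, h⟩ := zolotarevClass.norm_iteratedFDeriv_le hs hf 0 (Nat.zero_le _)
  refine ⟨C * 2 ^ s, by positivity, fun x => ?_⟩
  have h0 := h x
  rw [norm_iteratedFDeriv_zero, Real.norm_eq_abs, Nat.cast_zero, sub_zero] at h0
  rw [mul_assoc]
  exact h0.trans (mul_le_mul_of_nonneg_left (one_add_rpow_le hs.le (norm_nonneg x)) hC)

theorem zolotarevClass.smul_comp_mem {E F : Type*} [NormedAddCommGroup E] [NormedSpace ℝ E]
    [NormedAddCommGroup F] [NormedSpace ℝ F] {s : ℝ} (hs : 0 < s) {f : F → ℝ}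
    (hf : f ∈ zolotarevClass F s) {a : E →L[ℝ] F} (ha : a ≠ 0) :
    (fun x => (‖a‖ ^ s)⁻¹ • (f ∘ a) x) ∈ zolotarevClass E s := by
  have hα := ceil_sub_one_lt hs
  have ha' : 0 < ‖a‖ := norm_pos_iff.2 ha
  have hcomp : ContDiff ℝ (⌈s⌉₊ - 1 : ℕ) (f ∘ a) := hf.1.comp a.contDiff
  refine ⟨hcomp.const_smul _, fun x y => ?_⟩
  rw [iteratedFDeriv_const_smul_apply' hcomp.contDiffAt,
    iteratedFDeriv_const_smul_apply' hcomp.contDiffAt,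
    ← smul_sub, norm_smul, a.iteratedFDeriv_comp_right hf.1 x le_rfl,
    a.iteratedFDeriv_comp_right hf.1 y le_rfl]
  set m := ⌈s⌉₊ - 1
  have hsub : (iteratedFDeriv ℝ m f (a x)).compContinuousLinearMap (fun _ => a)
      - (iteratedFDeriv ℝ m f (a y)).compContinuousLinearMap (fun _ => a)
      = (iteratedFDeriv ℝ m f (a x) - iteratedFDeriv ℝ m f (a y)).compContinuousLinearMap
        (fun _ => a) := by
    ext v
    simp
  have hle : ‖(iteratedFDeriv ℝ m f (a x) - iteratedFDeriv ℝ m f (a y)).compContinuousLinearMap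
      (fun _ => a)‖ ≤ ‖a‖ ^ s * ‖x - y‖ ^ (s - m) :=
    calc _ ≤ ‖iteratedFDeriv ℝ m f (a x) - iteratedFDeriv ℝ m f (a y)‖ * ∏ _i : Fin m, ‖a‖ :=
          ContinuousMultilinearMap.norm_compContinuousLinearMap_le _ _
      _ ≤ (‖a‖ * ‖x - y‖) ^ (s - m) * ‖a‖ ^ m := by
          rw [Finset.prod_const, Finset.card_univ, Fintype.card_fin]
          gcongr
          refine (hf.2 (a x) (a y)).trans (Real.rpow_le_rpow (norm_nonneg _) ?_ (by linarith))
          rw [← map_sub]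
          exact a.le_opNorm _
      _ = ‖a‖ ^ s * ‖x - y‖ ^ (s - m) := by
          rw [Real.mul_rpow ha'.le (norm_nonneg _), mul_right_comm, ← Real.rpow_natCast ‖a‖ m,
            ← Real.rpow_add ha', sub_add_cancel]
  have hpos : 0 < ‖a‖ ^ s := Real.rpow_pos_of_pos ha' s
  rw [hsub, norm_inv, Real.norm_of_nonneg hpos.le, inv_mul_le_iff₀ hpos]
  exact hle

theorem ofReal_abs_integral_comp_sub_le {E F : Type*} [NormedAddCommGroup E] [NormedSpace ℝ E]
    [MeasurableSpace E] [NormedAddCommGroup F] [NormedSpace ℝ F] {s : ℝ} (hs : 0 < s)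
    {f : F → ℝ} (hf : f ∈ zolotarevClass F s) (a : E →L[ℝ] F) (μ ν : Measure E)
    [IsProbabilityMeasure μ] [IsProbabilityMeasure ν] :
    ENNReal.ofReal |∫ x, f (a x) ∂μ - ∫ x, f (a x) ∂ν|
      ≤ ENNReal.ofReal (‖a‖ ^ s) * zolotarevDist s μ ν := by
  rcases eq_or_ne a 0 with rfl | ha
  · simp
  have hpos : 0 < ‖a‖ ^ s := Real.rpow_pos_of_pos (norm_pos_iff.2 ha) s
  have hle : ENNReal.ofReal |∫ x, (‖a‖ ^ s)⁻¹ • (f ∘ a) x ∂μ - ∫ x, (‖a‖ ^ s)⁻¹ • (f ∘ a) x ∂ν|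
      ≤ zolotarevDist s μ ν :=
    le_iSup₂ (f := fun g (_ : g ∈ zolotarevClass E s) =>
      ENNReal.ofReal |∫ x, g x ∂μ - ∫ x, g x ∂ν|) _ (zolotarevClass.smul_comp_mem hs hf ha)
  refine le_trans (le_of_eq ?_) (mul_le_mul_right hle _)
  rw [integral_smul, integral_smul, ← smul_sub, smul_eq_mul, abs_mul,
    abs_of_pos (inv_pos.2 hpos), ← ENNReal.ofReal_mul hpos.le, mul_inv_cancel_left₀ hpos.ne']
  rfl

theorem measurable_opNorm_of_eval {T E F : Type*} [MeasurableSpace T] [NormedAddCommGroup E]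
    [NormedSpace ℝ E] [TopologicalSpace.SeparableSpace E] [NormedAddCommGroup F] [NormedSpace ℝ F]
    [MeasurableSpace F] [OpensMeasurableSpace F] {A : T → E →L[ℝ] F}
    (hA : ∀ x, Measurable fun t => A t x) : Measurable fun t => ‖A t‖ := by
  refine measurable_of_Iic fun c => ?_
  rcases lt_or_ge c 0 with hc | hc
  · convert MeasurableSet.empty
    ext t
    simpa using hc.trans_le (norm_nonneg (A t))
  · have h : (fun t => ‖A t‖) ⁻¹' Set.Iic c =
        ⋂ n, {t | ‖A t (TopologicalSpace.denseSeq E n)‖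
          ≤ c * ‖TopologicalSpace.denseSeq E n‖} := by
      ext t
      simp only [Set.mem_preimage, Set.mem_Iic, Set.mem_iInter, Set.mem_ofPred_eq]
      refine ⟨fun h n => (A t).le_of_opNorm_le h _, fun h => ?_⟩
      refine (A t).opNorm_le_bound hc fun x => ?_
      refine (TopologicalSpace.denseRange_denseSeq E).induction_on x
        (isClosed_le (by fun_prop) (by fun_prop)) h
    rw [h]
    exact MeasurableSet.iInter fun n => measurableSet_le (hA _).norm measurable_const

theorem MemMs.integrable_norm_rpow {E : Type*} [NormedAddCommGroup E] [NormedSpace ℝ E]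
    [MeasurableSpace E] [OpensMeasurableSpace E] {s : ℝ} {μ : Measure E} (h : MemMs s μ) :
    Integrable (fun x => ‖x‖ ^ s) μ := by
  refine ⟨(measurable_norm.pow_const s).aestronglyMeasurable, ?_⟩
  rw [hasFiniteIntegral_iff_ofReal (Eventually.of_forall fun x => by positivity)]
  exact h.2

section RandomOperator

variable {T E F : Type*} [MeasurableSpace T] [NormedAddCommGroup E] [NormedSpace ℝ E]
  [MeasurableSpace E] [BorelSpace E] [SecondCountableTopology E] [NormedAddCommGroup F]
  [NormedSpace ℝ F] [MeasurableSpace F] [BorelSpace F] {A : T → E →L[ℝ] F}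

theorem measurable_uncurry_of_eval (hA : ∀ x, Measurable fun t => A t x) :
    Measurable fun p : T × E => A p.1 p.2 :=
  (measurable_uncurry_of_continuous_of_measurable (u := fun (x : E) (t : T) => A t x)
    (fun t => (A t).continuous) hA).comp measurable_swap

variable {s : ℝ} {f : F → ℝ}

theorem zolotarevClass.integrable_prod (hs : 0 < s) (hA : ∀ x, Measurable fun t => A t x)
    (hf : f ∈ zolotarevClass F s) (κ : Measure T) (μ : Measure E) [IsProbabilityMeasure κ]
    [IsProbabilityMeasure μ] (hκ : Integrable (fun t => ‖A t‖ ^ s) κ)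
    (hμ : Integrable (fun x => ‖x‖ ^ s) μ) :
    Integrable (fun p : T × E => f (A p.1 p.2)) (κ.prod μ) := by
  obtain ⟨C, hC, h⟩ := zolotarevClass.exists_abs_le hs hf
  refine (((integrable_const (1 : ℝ)).add (hκ.mul_prod hμ)).const_mul C).mono'
    (hf.1.continuous.measurable.comp (measurable_uncurry_of_eval hA)).aestronglyMeasurable
    (Eventually.of_forall fun p => (h _).trans ?_)
  simp only [Pi.add_apply]
  rw [← Real.mul_rpow (norm_nonneg _) (norm_nonneg _)]
  gcongr
  exact (A p.1).le_opNorm p.2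

variable {Ω : Type*} [MeasurableSpace Ω] {P : Measure Ω} [IsProbabilityMeasure P] {S : Ω → T}

theorem zolotarevClass.integral_map_eval (hs : 0 < s) (hA : ∀ x, Measurable fun t => A t x)
    (hf : f ∈ zolotarevClass F s) (hS : Measurable S)
    (hSint : Integrable (fun t => ‖A t‖ ^ s) (P.map S)) {X : Ω → E} (hX : Measurable X)
    (hXs : MemMs s (P.map X)) (hind : IndepFun S X P) :
    Integrable (fun t => ∫ x, f (A t x) ∂(P.map X)) (P.map S) ∧
      ∫ y, f y ∂(P.map fun ω => A (S ω) (X ω)) = ∫ t, ∫ x, f (A t x) ∂(P.map X) ∂(P.map S) := by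
  have := hXs.1
  have := Measure.isProbabilityMeasure_map (μ := P) hS.aemeasurable
  have hprod := zolotarevClass.integrable_prod hs hA hf (P.map S) (P.map X) hSint
    hXs.integrable_norm_rpow
  have hev := measurable_uncurry_of_eval hA
  refine ⟨hprod.integral_prod_left, ?_⟩
  rw [← integral_prod _ hprod,
    ← (indepFun_iff_map_prod_eq_prod_map_map hS.aemeasurable hX.aemeasurable).1 hind,
    integral_map (f := fun p : T × E => f (A p.1 p.2)) (hS.prodMk hX).aemeasurable
      (hf.1.continuous.measurable.comp hev).aestronglyMeasurable]
  exact integral_map (hev.comp (hS.prodMk hX)).aemeasurable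
    hf.1.continuous.measurable.aestronglyMeasurable

theorem zolotarevDist_map_eval_le (hs : 0 < s) (hA : ∀ x, Measurable fun t => A t x)
    (hS : Measurable S) (hSint : Integrable (fun ω => ‖A (S ω)‖ ^ s) P) {X Y : Ω → E}
    (hX : Measurable X) (hY : Measurable Y) (hXs : MemMs s (P.map X)) (hYs : MemMs s (P.map Y))
    (hindX : IndepFun S X P) (hindY : IndepFun S Y P) :
    zolotarevDist s (P.map fun ω => A (S ω) (X ω)) (P.map fun ω => A (S ω) (Y ω))
      ≤ ENNReal.ofReal (∫ ω, ‖A (S ω)‖ ^ s ∂P) * zolotarevDist s (P.map X) (P.map Y) := by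
  have := hXs.1
  have := hYs.1
  have hnorm : Measurable fun t => ‖A t‖ ^ s := (measurable_opNorm_of_eval hA).pow_const s
  have hSint' : Integrable (fun t => ‖A t‖ ^ s) (P.map S) :=
    (integrable_map_measure hnorm.aestronglyMeasurable hS.aemeasurable).2 hSint
  refine iSup₂_le fun f hf => ?_
  obtain ⟨hiX, heX⟩ := zolotarevClass.integral_map_eval hs hA hf hS hSint' hX hXs hindX
  obtain ⟨hiY, heY⟩ := zolotarevClass.integral_map_eval hs hA hf hS hSint' hY hYs hindY
  rw [heX, heY, ← integral_sub hiX hiY]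
  calc _ = ‖∫ t, (∫ x, f (A t x) ∂(P.map X) - ∫ x, f (A t x) ∂(P.map Y)) ∂(P.map S)‖ₑ := by
        rw [← Real.norm_eq_abs, ofReal_norm]
    _ ≤ ∫⁻ t, ‖∫ x, f (A t x) ∂(P.map X) - ∫ x, f (A t x) ∂(P.map Y)‖ₑ ∂(P.map S) :=
        enorm_integral_le_lintegral_enorm _
    _ ≤ ∫⁻ t, ENNReal.ofReal (‖A t‖ ^ s) * zolotarevDist s (P.map X) (P.map Y) ∂(P.map S) := by
        refine lintegral_mono fun t => ?_
        rw [← ofReal_norm, Real.norm_eq_abs]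
        exact ofReal_abs_integral_comp_sub_le hs hf (A t) _ _
    _ = _ := by
        rw [lintegral_mul_const _ hnorm.ennreal_ofReal, lintegral_map hnorm.ennreal_ofReal hS,
          ofReal_integral_eq_lintegral_ofReal hSint
            (Eventually.of_forall fun ω => by positivity)]

end RandomOperator

theorem measurable_eval_evalSigma {B F : Type*} [NormedAddCommGroup B] [NormedSpace ℝ B]
    [NormedAddCommGroup F] [NormedSpace ℝ F] [MeasurableSpace F] (x : B) :
    @Measurable _ _ (evalSigma B F) _ (fun a : B →L[ℝ] F => a x) :=
  Measurable.of_comap_le (le_iSup (fun x : B =>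
    MeasurableSpace.comap (fun a : B →L[ℝ] F => a x) inferInstance) x)

theorem zolotarev_random_linear_le
    {Ω B : Type*} [MeasurableSpace Ω]
    [NormedAddCommGroup B] [NormedSpace ℝ B] [MeasurableSpace B] [BorelSpace B]
    [SecondCountableTopology B] [CompleteSpace B]
    (P : Measure Ω) [IsProbabilityMeasure P]
    (s : ℝ) (hs : 0 < s) (ν : Measure B) (hν : MemMs s ν)
    (X Y : Ω → B) (hX : Measurable X) (hY : Measurable Y)
    (hXν : MemMsOf s ν (P.map X)) (hYν : MemMsOf s ν (P.map Y)) :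
    (∀ A : Ω → (B →L[ℝ] B),
      @Measurable _ _ _ (evalSigma B B) A →
      Integrable (fun ω => ‖A ω‖ ^ s) P →
      (@IndepFun _ _ _ _ (evalSigma B B) _ A X P) →
      (@IndepFun _ _ _ _ (evalSigma B B) _ A Y P) →
      zolotarevDist s (P.map (fun ω => A ω (X ω))) (P.map (fun ω => A ω (Y ω)))
        ≤ ENNReal.ofReal (∫ ω, ‖A ω‖ ^ s ∂P) * zolotarevDist s (P.map X) (P.map Y)) ∧
    (∀ A : Ω → (B →L[ℝ] ℝ),
      @Measurable _ _ _ (evalSigma B ℝ) A →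
      Integrable (fun ω => ‖A ω‖ ^ s) P →
      (@IndepFun _ _ _ _ (evalSigma B ℝ) _ A X P) →
      (@IndepFun _ _ _ _ (evalSigma B ℝ) _ A Y P) →
      zolotarevDist s (P.map (fun ω => A ω (X ω))) (P.map (fun ω => A ω (Y ω)))
        ≤ ENNReal.ofReal (∫ ω, ‖A ω‖ ^ s ∂P) * zolotarevDist s (P.map X) (P.map Y)) := by
  exact ⟨fun A hA hAs hAX hAY =>
      @zolotarevDist_map_eval_le _ B B (evalSigma B B) _ _ _ _ _ _ _ _ _ id s _ _ P _ A hs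
        measurable_eval_evalSigma hA hAs X Y hX hY hXν.1 hYν.1 hAX hAY,
    fun A hA hAs hAX hAY =>
      @zolotarevDist_map_eval_le _ B ℝ (evalSigma B ℝ) _ _ _ _ _ _ _ _ _ id s _ _ P _ A hs
        measurable_eval_evalSigma hA hAs X Y hX hY hXν.1 hYν.1 hAX hAY⟩

end
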